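/- Let S be a Lie subalgebra of P under the Poisson bracket with B ⊆ S and S ≠ P. Then either S ⊆ P¹ or S = V_α for some α ∈ ℝ. -/

import Mathlib

noncomputable section

open Complex

/-- Partial derivative in the first (angle) variable. -/
def pdTheta (f : ℝ × ℝ → ℝ) : ℝ × ℝ → ℝ := fun p => deriv (fun t => f (t, p.2)) p.1

/-- Partial derivative in the second (momentum) variable. -/
def pdEll (f : ℝ × ℝ → ℝ) : ℝ × ℝ → ℝ := fun p => deriv (fun l => f (p.1, l)) p.2

/-- Poisson bracket `{f,g} = f_ℓ g_θ − f_θ g_ℓ`. -/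
def pb (f g : ℝ × ℝ → ℝ) : ℝ × ℝ → ℝ :=
  fun p => pdEll f p * pdTheta g p - pdTheta f p * pdEll g p

/-- Spanning set for the polynomial algebra `P`. -/
def PGens : Set (ℝ × ℝ → ℝ) :=
  {h | ∃ r m : ℕ, h = (fun p : ℝ × ℝ => p.2 ^ r * Real.sin (m * p.1)) ∨
       h = (fun p : ℝ × ℝ => p.2 ^ r * Real.cos (m * p.1))}

/-- The polynomial algebra `P`. -/
def P : Submodule ℝ (ℝ × ℝ → ℝ) := Submodule.span ℝ PGens

def fone : ℝ × ℝ → ℝ := fun _ => 1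
def fell : ℝ × ℝ → ℝ := fun p => p.2
def fsin : ℝ × ℝ → ℝ := fun p => Real.sin p.1
def fcos : ℝ × ℝ → ℝ := fun p => Real.cos p.1

lemma fone_mem_P : fone ∈ P :=
  Submodule.subset_span ⟨0, 0, Or.inr (by funext p; simp [fone])⟩

lemma fell_mem_P : fell ∈ P :=
  Submodule.subset_span ⟨1, 0, Or.inr (by funext p; simp [fell])⟩

lemma fsin_mem_P : fsin ∈ P :=
  Submodule.subset_span ⟨0, 1, Or.inl (by funext p; simp [fsin])⟩

lemma fcos_mem_P : fcos ∈ P :=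
  Submodule.subset_span ⟨0, 1, Or.inr (by funext p; simp [fcos])⟩

/-- The domain `D = C^∞(S¹,ℂ)`: smooth `2π`-periodic functions. -/
def Dom : Submodule ℂ (ℝ → ℂ) where
  carrier := {ψ | ContDiff ℝ (⊤ : ℕ∞) ψ ∧ ∀ t, ψ (t + 2 * Real.pi) = ψ t}
  add_mem' := by
    intro a b ha hb
    exact ⟨ha.1.add hb.1, fun t => by simp [Pi.add_apply, ha.2 t, hb.2 t]⟩
  zero_mem' := ⟨contDiff_const, fun t => rfl⟩
  smul_mem' := by
    intro c a ha
    exact ⟨ha.1.const_smul c, fun t => by simp [Pi.smul_apply, ha.2 t]⟩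

/-- The `L²` inner product on `D`. -/
def ip (φ ψ : ℝ → ℂ) : ℂ := ∫ t in (0:ℝ)..(2 * Real.pi), (starRingEnd ℂ) (φ t) * ψ t

/-- Symmetric operator on `D`. -/
def SymmetricOp (A : Dom →ₗ[ℂ] Dom) : Prop :=
  ∀ φ ψ : Dom, ip (A φ : ℝ → ℂ) (ψ : ℝ → ℂ) = ip (φ : ℝ → ℂ) (A ψ : ℝ → ℂ)

/-- An admissible quantization of type (i)′ with parameter ν of a Lie subalgebra
`O ⊆ P` containing the basic set. -/
structure IsQuant (O : Submodule ℝ (ℝ × ℝ → ℝ)) (ν : ℝ)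
    (Q : O →ₗ[ℝ] (Dom →ₗ[ℂ] Dom)) : Prop where
  map_bracket : ∀ (f g : O) (h : pb f g ∈ O),
    Q ⟨pb f g, h⟩ = Complex.I • (Q f ∘ₗ Q g - Q g ∘ₗ Q f)
  map_one : ∀ h : fone ∈ O, Q ⟨fone, h⟩ = LinearMap.id
  symm : ∀ f : O, SymmetricOp (Q f)
  map_ell : ∀ (h : fell ∈ O) (ψ : Dom) (t : ℝ),
    (Q ⟨fell, h⟩ ψ : ℝ → ℂ) t = -Complex.I * deriv (ψ : ℝ → ℂ) t + (ν : ℂ) * (ψ : ℝ → ℂ) t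
  map_sin : ∀ (h : fsin ∈ O) (ψ : Dom) (t : ℝ),
    (Q ⟨fsin, h⟩ ψ : ℝ → ℂ) t = (Real.sin t : ℂ) * (ψ : ℝ → ℂ) t
  map_cos : ∀ (h : fcos ∈ O) (ψ : Dom) (t : ℝ),
    (Q ⟨fcos, h⟩ ψ : ℝ → ℂ) t = (Real.cos t : ℂ) * (ψ : ℝ → ℂ) t

end
noncomputable section
/-- Spanning set of real trigonometric polynomials. -/
def TrigGens : Set (ℝ → ℝ) :=
  {h | ∃ m : ℕ, h = (fun t => Real.sin (m * t)) ∨ h = fun t => Real.cos (m * t)}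

/-- Real trigonometric polynomials. -/
def Trig : Submodule ℝ (ℝ → ℝ) := Submodule.span ℝ TrigGens

/-- Spanning set for `P¹`, the elements of `P` of degree at most 1 in `ℓ`. -/
def P1Gens : Set (ℝ × ℝ → ℝ) :=
  {h | ∃ r m : ℕ, r ≤ 1 ∧
        (h = (fun p : ℝ × ℝ => p.2 ^ r * Real.sin (m * p.1)) ∨
         h = (fun p : ℝ × ℝ => p.2 ^ r * Real.cos (m * p.1)))}

/-- `P¹ ⊆ P`: polynomials affine in the momentum `ℓ`. -/
def P1 : Submodule ℝ (ℝ × ℝ → ℝ) := Submodule.span ℝ P1Gens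

lemma fone_mem_P1 : fone ∈ P1 :=
  Submodule.subset_span ⟨0, 0, Nat.zero_le 1, Or.inr (by funext p; simp [fone])⟩
lemma fell_mem_P1 : fell ∈ P1 :=
  Submodule.subset_span ⟨1, 0, le_refl 1, Or.inr (by funext p; simp [fell])⟩
lemma fsin_mem_P1 : fsin ∈ P1 :=
  Submodule.subset_span ⟨0, 1, Nat.zero_le 1, Or.inl (by funext p; simp [fsin])⟩
lemma fcos_mem_P1 : fcos ∈ P1 :=
  Submodule.subset_span ⟨0, 1, Nat.zero_le 1, Or.inr (by funext p; simp [fcos])⟩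
end
noncomputable section
/-- Partial θ-derivative of a complex-valued function. -/
def pdThetaC (f : ℝ × ℝ → ℂ) : ℝ × ℝ → ℂ := fun p => deriv (fun t => f (t, p.2)) p.1
/-- Partial ℓ-derivative of a complex-valued function. -/
def pdEllC (f : ℝ × ℝ → ℂ) : ℝ × ℝ → ℂ := fun p => deriv (fun l => f (p.1, l)) p.2
/-- Poisson bracket of complex-valued functions. -/
def pbC (f g : ℝ × ℝ → ℂ) : ℝ × ℝ → ℂ :=
  fun p => pdEllC f p * pdThetaC g p - pdThetaC f p * pdEllC g p

/-- `e^r_m = ℓ^r e^{imθ}`. -/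
def eC (r : ℕ) (m : ℤ) : ℝ × ℝ → ℂ :=
  fun p => (p.2 : ℂ) ^ r * Complex.exp (Complex.I * (m : ℂ) * (p.1 : ℂ))

/-- The complexification `P_ℂ` of `P`. -/
def PC : Submodule ℂ (ℝ × ℝ → ℂ) :=
  Submodule.span ℂ {h | ∃ (r : ℕ) (m : ℤ), h = eC r m}

/-- Closure under the Poisson bracket (complex case). -/
def IsLieSubC (S : Submodule ℂ (ℝ × ℝ → ℂ)) : Prop :=
  ∀ f g : ℝ × ℝ → ℂ, f ∈ S → g ∈ S → pbC f g ∈ S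

/-- The generators of `W_α`: `1, e^0_1, e^0_{−1}, e^1_0` and
`e^2_{2N+1} + 2α e^1_{2N+1}` for all `N ∈ ℤ`. -/
def WGens (α : ℝ) : Set (ℝ × ℝ → ℂ) :=
  {fun _ => 1, eC 0 1, eC 0 (-1), eC 1 0} ∪
    {h | ∃ N : ℤ, h = eC 2 (2 * N + 1) + (2 * α : ℂ) • eC 1 (2 * N + 1)}

/-- `W_α`: the smallest complex Lie subalgebra of `P_ℂ` containing the generators. -/
def W (α : ℝ) : Submodule ℂ (ℝ × ℝ → ℂ) :=
  sInf {S | S ≤ PC ∧ WGens α ⊆ S ∧ IsLieSubC S}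

/-- The complexification of a real-valued function. -/
def cplx (f : ℝ × ℝ → ℝ) : ℝ × ℝ → ℂ := fun p => (f p : ℂ)

/-- `V_α`: the real elements of `W_α`, a real Lie subalgebra of `P`. -/
def V (α : ℝ) : Submodule ℝ (ℝ × ℝ → ℝ) where
  carrier := {f | cplx f ∈ W α}
  add_mem' := by
    intro a b ha hb
    simp only [Set.mem_setOf_eq] at *
    have h : cplx (a + b) = cplx a + cplx b := by
      funext p; simp [cplx]
    rw [h]; exact add_mem ha hb
  zero_mem' := by
    simp only [Set.mem_setOf_eq]
    have h : cplx (0 : ℝ × ℝ → ℝ) = 0 := by funext p; simp [cplx]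
    rw [h]; exact zero_mem _
  smul_mem' := by
    intro c a ha
    simp only [Set.mem_setOf_eq] at *
    have h : cplx (c • a) = (c : ℂ) • cplx a := by
      funext p; simp [cplx]
    rw [h]; exact Submodule.smul_mem _ _ ha
end
noncomputable section
/-- The basic set `B = span{1, ℓ, sin θ, cos θ}`. -/
def Bsub : Submodule ℝ (ℝ × ℝ → ℝ) := Submodule.span ℝ {fone, fell, fsin, fcos}

/-- Closure under the Poisson bracket. -/
def IsLieSub (S : Submodule ℝ (ℝ × ℝ → ℝ)) : Prop :=
  ∀ f g : ℝ × ℝ → ℝ, f ∈ S → g ∈ S → pb f g ∈ S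

section
open Polynomial

structure GoodU (U : ℤ → Submodule ℂ ℂ[X]) : Prop where
  br : ∀ m n p q, p ∈ U m → q ∈ U n →
    (C (n:ℂ) * (derivative p * q) - C (m:ℂ) * (p * derivative q)) ∈ U (m+n)
  one0 : (1:ℂ[X]) ∈ U 0
  X0 : (X:ℂ[X]) ∈ U 0
  one1 : (1:ℂ[X]) ∈ U 1
  onem1 : (1:ℂ[X]) ∈ U (-1)

def HH (U : ℤ → Submodule ℂ ℂ[X]) (r : ℕ) (n : ℤ) : Prop :=
  ∃ p ∈ U n, p.natDegree ≤ r ∧ p.coeff r = 1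

namespace GoodU
lemma C2 : (C (2:ℂ) : ℂ[X]) = 2 := map_ofNat C 2
lemma C3 : (C (3:ℂ) : ℂ[X]) = 3 := map_ofNat C 3
lemma C4 : (C (4:ℂ) : ℂ[X]) = 4 := map_ofNat C 4
variable {U : ℤ → Submodule ℂ ℂ[X]}

lemma HH_of {r : ℕ} {n : ℤ} {p : ℂ[X]} (hp : p ∈ U n) (h1 : p.natDegree ≤ r)
    (h2 : p.coeff r ≠ 0) : HH U r n := by
  refine ⟨(p.coeff r)⁻¹ • p, (U n).smul_mem _ hp, (natDegree_smul_le _ _).trans h1, ?_⟩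
  simp [h2]

lemma coeff_dmul {p q : ℂ[X]} {r s t : ℕ} (hp : p.natDegree ≤ r) (hq : q.natDegree ≤ s)
    (ht : r + s = t + 1) : (derivative p * q).natDegree ≤ t ∧
      (derivative p * q).coeff t = r * (p.coeff r * q.coeff s) := by
  rcases r with _ | r
  · have : derivative p = 0 := by
      rw [eq_C_of_natDegree_le_zero hp]; simp
    simp [this]
  · have h1 : (derivative p).natDegree ≤ r :=
      (natDegree_derivative_le p).trans (by omega)
    have ht' : t = r + s := by omega
    subst ht'
    refine ⟨natDegree_mul_le_of_le h1 hq, ?_⟩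
    rw [coeff_mul_add_eq_of_natDegree_le h1 hq, coeff_derivative]
    push_cast; ring

lemma HHbr (hU : GoodU U) {r s t : ℕ} {m n k : ℤ} (h1 : HH U r m) (h2 : HH U s n)
    (ht : r + s = t + 1) (hk : m + n = k) (hne : (r:ℤ) * n - s * m ≠ 0) : HH U t k := by
  obtain ⟨p, hp, hpd, hpc⟩ := h1
  obtain ⟨q, hq, hqd, hqc⟩ := h2
  subst hk
  have a := coeff_dmul hpd hqd ht
  have b := coeff_dmul hqd hpd (show s + r = t + 1 by omega)
  rw [mul_comm] at b
  refine HH_of (hU.br m n p q hp hq) ?_ ?_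
  · refine (natDegree_sub_le _ _).trans (max_le ?_ ?_)
    · exact (natDegree_C_mul_le _ _).trans a.1
    · exact (natDegree_C_mul_le _ _).trans b.1
  · rw [coeff_sub, coeff_C_mul, coeff_C_mul, a.2, b.2, hpc, hqc]
    intro h
    apply hne
    have : (((r:ℤ) * n - s * m : ℤ) : ℂ) = 0 := by push_cast; linear_combination h
    exact_mod_cast this

lemma H00 (hU : GoodU U) : HH U 0 0 := ⟨1, hU.one0, by simp, by simp⟩
lemma H10 (hU : GoodU U) : HH U 1 0 := ⟨X, hU.X0, by simp, by simp⟩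
lemma H01 (hU : GoodU U) : HH U 0 1 := ⟨1, hU.one1, by simp, by simp⟩
lemma H0m1 (hU : GoodU U) : HH U 0 (-1) := ⟨1, hU.onem1, by simp, by simp⟩

lemma Hup (hU : GoodU U) {r : ℕ} {n : ℤ} (h : HH U (r+1) n) : HH U r (n+1) :=
  hU.HHbr hU.H01 h (by omega) (by omega) (by push_cast; omega)
lemma Hdown (hU : GoodU U) {r : ℕ} {n : ℤ} (h : HH U (r+1) n) : HH U r (n-1) :=
  hU.HHbr hU.H0m1 h (by omega) (by omega) (by push_cast; omega)

lemma one_mem {n : ℤ} (h : HH U 0 n) : (1:ℂ[X]) ∈ U n := by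
  obtain ⟨p, hp, hd, hc⟩ := h
  rw [eq_C_of_natDegree_le_zero hd, hc] at hp
  simpa using hp

lemma Hupd (hU : GoodU U) (d : ℕ) {r : ℕ} {n : ℤ} (h : HH U (r+d) n) : HH U r (n+d) := by
  induction d generalizing n with
  | zero => simpa using h
  | succ d ih =>
    have := ih (hU.Hup (r := r + d) h)
    convert this using 1; push_cast; ring
lemma Hdownd (hU : GoodU U) (d : ℕ) {r : ℕ} {n : ℤ} (h : HH U (r+d) n) : HH U r (n-d) := by
  induction d generalizing n with
  | zero => simpa using h
  | succ d ih =>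
    have := ih (hU.Hdown (r := r + d) h)
    convert this using 1; push_cast; ring

/-- step: from degree 2 at odd m to m±2 -/
lemma H2odd (hU : GoodU U) (h1 : HH U 2 1) (h2 : HH U 2 (-1)) (N : ℤ) : HH U 2 (2*N+1) := by
  have u : HH U 1 2 := hU.Hup h1
  have d : HH U 1 (-2) := hU.Hdown h2
  induction N using Int.induction_on with
  | zero => simpa using h1
  | succ i ih => exact hU.HHbr u ih (by omega) (by ring) (by push_cast; omega)
  | pred i ih => exact hU.HHbr d ih (by omega) (by ring) (by push_cast; omega)

lemma H2of (hU : GoodU U) (hconj : ∀ r n, HH U r n → HH U r (-n)) {d : ℕ} {n : ℤ} (hd : 2 ≤ d)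
    (h : HH U d n) (N : ℤ) : HH U 2 (2*N+1) := by
  obtain ⟨e, rfl⟩ := Nat.exists_eq_add_of_le hd
  have h := hU.Hupd e h
  generalize n + (e:ℤ) = k at h
  have key : HH U 2 1 := by
    by_cases hk : k = 0
    · subst hk
      have := hU.Hup h
      exact hU.HHbr h this (by omega) (by omega) (by simp)
    · have : HH U 3 0 := hU.HHbr h (hconj _ _ h) (by omega) (by omega) (by push_cast; omega)
      exact hU.Hup this
  exact hU.H2odd key (hconj _ _ key) N

lemma top_of_H (h : ∀ r n, HH U r n) (n : ℤ) : U n = ⊤ := by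
  rw [eq_top_iff]
  have : ∀ d : ℕ, ∀ p : ℂ[X], p.natDegree < d → p ∈ U n := by
    intro d
    induction d with
    | zero => intro p hp; omega
    | succ d ih =>
      intro p hp
      obtain ⟨q, hq, hqd, hqc⟩ := h d n
      by_cases hd : d = 0
      · subst hd
        rw [eq_C_of_natDegree_le_zero (p := p) (by omega)]
        have := (U n).smul_mem (p.coeff 0) (one_mem (h 0 n))
        rwa [smul_eq_C_mul, mul_one] at this
      have : p - p.coeff d • q ∈ U n := by
        apply ih
        have : (p - p.coeff d • q).natDegree ≤ d - 1 := by
          rw [natDegree_le_iff_coeff_eq_zero]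
          intro N hN
          by_cases hNd : N = d
          · subst hNd; simp [hqc]
          · rw [coeff_sub, coeff_smul, coeff_eq_zero_of_natDegree_lt (p := p) (by omega),
              coeff_eq_zero_of_natDegree_lt (p := q) (by omega)]; simp
        omega
      have := (U n).add_mem this ((U n).smul_mem (p.coeff d) hq)
      simpa using this
  intro p _
  exact this _ p (Nat.lt_succ_self _)

lemma full (hU : GoodU U) (h2 : ∀ N, HH U 2 (2*N+1)) {k : ℤ} (hk : Even k) (hk0 : k ≠ 0)
    (h : HH U 0 k) (n : ℤ) : U n = ⊤ := by
  obtain ⟨k', hk'⟩ := hk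
  have h1o : ∀ N, HH U 1 (2*N+1) := fun N =>
    hU.HHbr h (h2 (N-k')) (by omega) (by omega) (by push_cast; omega)
  have h0e : ∀ N, HH U 0 (2*N) := fun N => by simpa using hU.Hdown (h1o N)
  have h1e : ∀ N, HH U 1 (2*N) := fun N => by simpa using hU.Hdown (h2 N)
  have h0o : ∀ N, HH U 0 (2*N+1) := fun N => hU.Hup (h1e N)
  have h2e : ∀ N, HH U 2 (2*N) := fun N =>
    hU.HHbr (h1o 0) (h2 (N-1)) (by omega) (by omega) (by push_cast; omega)
  have h0 : ∀ n, HH U 0 n := fun n => by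
    rcases Int.even_or_odd' n with ⟨c, rfl | rfl⟩
    · exact h0e c
    · exact h0o c
  have h1 : ∀ n, HH U 1 n := fun n => by
    rcases Int.even_or_odd' n with ⟨c, rfl | rfl⟩
    · exact h1e c
    · exact h1o c
  have h2 : ∀ n, HH U 2 n := fun n => by
    rcases Int.even_or_odd' n with ⟨c, rfl | rfl⟩
    · exact h2e c
    · exact h2 c
  refine top_of_H (fun r => ?_) n
  induction r with
  | zero => exact h0
  | succ r ih =>
    intro n
    by_cases hn : n = 0
    · exact hU.HHbr (ih (-1)) (h2 1) (by omega) (by omega) (by push_cast; omega)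
    · exact hU.HHbr (ih n) (h2 0) (by omega) (by omega) (by push_cast; omega)

lemma smul_cancel {n : ℤ} {c : ℂ} (hc : c ≠ 0) {p q : ℂ[X]} (hq : q ∈ U n)
    (h : q = C c * p) : p ∈ U n := by
  have := (U n).smul_mem c⁻¹ hq
  rwa [h, ← smul_eq_C_mul, smul_smul, inv_mul_cancel₀ hc, one_smul] at this

/-- derivative -/
lemma dup (hU : GoodU U) {n : ℤ} {p : ℂ[X]} (h : p ∈ U n) : derivative p ∈ U (n+1) := by
  have := hU.br 1 n 1 p hU.one1 h
  rw [add_comm] at this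
  simpa using this
lemma ddown (hU : GoodU U) {n : ℤ} {p : ℂ[X]} (h : p ∈ U n) : derivative p ∈ U (n-1) := by
  have := hU.br (-1) n 1 p hU.onem1 h
  rw [add_comm] at this
  simpa [sub_eq_add_neg] using this

lemma gen (hU : GoodU U) {α : ℂ} (h2 : ∀ N, X^2 + C (2*α) * X ∈ U (2*N+1)) (r : ℕ) :
    ∀ m : ℤ, Odd (r + m) → (X + C α)^r ∈ U m := by
  have h1e : ∀ N : ℤ, X + C α ∈ U (2*N) := fun N => by
    have := hU.ddown (h2 N)
    refine smul_cancel (c := 2) two_ne_zero (q := derivative (X^2 + C (2*α) * X)) ?_ ?_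
    · convert this using 2; ring
    · simp [C2]; ring
  have h0o : ∀ N : ℤ, (1:ℂ[X]) ∈ U (2*N+1) := fun N => by
    have := hU.dup (h1e N)
    simpa using this
  have h2' : ∀ N : ℤ, (X + C α)^2 ∈ U (2*N+1) := fun N => by
    have := (U _).add_mem (h2 N) ((U _).smul_mem (α^2) (h0o N))
    convert this using 1
    rw [smul_eq_C_mul]; simp [C2]; ring
  induction r with
  | zero => 
    rintro m ⟨c, hc⟩
    have : m = 2 * c + 1 := by push_cast at hc; omega
    subst this; simpa using h0o c
  | succ r ih =>
    rintro m ⟨c, hc⟩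
    push_cast at hc
    obtain ⟨N, hN⟩ : ∃ N : ℤ, (r:ℤ) * (2*N+1) - 2 * (m - (2*N+1)) ≠ 0 := by
      by_cases h : (r:ℤ) * (2*0+1) - 2 * (m - (2*0+1)) = 0
      · exact ⟨-1, by omega⟩
      · exact ⟨0, h⟩
    have hA := ih (m - (2*N+1)) ⟨c - N - 1, by omega⟩
    have hB := hU.br _ _ _ _ hA (h2' N)
    rw [sub_add_cancel] at hB
    refine smul_cancel (c := (((r:ℤ) * (2*N+1) - 2 * (m - (2*N+1)) : ℤ) : ℂ))
      (by exact_mod_cast hN) hB ?_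
    rcases r with _ | r
    · rw [derivative_X_add_C_pow, derivative_X_add_C_pow]; simp [C2]; ring
    · rw [derivative_X_add_C_pow, derivative_X_add_C_pow]; simp [C2]; ring

lemma uniq (hU : GoodU U) (h2 : ∀ N, HH U 2 (2*N+1)) (hnf : ¬ ∀ n, U n = ⊤) {N : ℤ} {a b : ℂ}
    (ha : X^2 + C (2*a) * X ∈ U (2*N+1)) {c : ℂ} (hb : X^2 + C (2*b) * X + C c ∈ U (2*N+1)) :
    a = b := by
  by_contra hab
  apply hnf
  have h := (U _).sub_mem ha hb
  have e : X^2 + C (2*a) * X - (X^2 + C (2*b) * X + C c) = C (2*(a-b)) * X + C (-c) := by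
    simp; ring
  rw [e] at h
  have h1 : HH U 1 (2*N+1) := HH_of h natDegree_linear_le (by
    simp [coeff_C]; exact sub_ne_zero.2 hab)
  by_cases hN : N = 0
  · exact hU.full h2 (k := 2*N+1+1) ⟨N+1, by ring⟩ (by omega) (hU.Hup h1)
  · exact hU.full h2 (k := 2*N+1-1) ⟨N, by ring⟩ (by omega) (hU.Hdown h1)

lemma exA (hU : GoodU U) (h2 : ∀ N, HH U 2 (2*N+1)) (N : ℤ) :
    ∃ a : ℂ, X^2 + C (2*a) * X ∈ U (2*N+1) := by
  have h0 : (1:ℂ[X]) ∈ U (2*N+1) := by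
    have : HH U 1 (2*N) := by simpa using hU.Hdown (h2 N)
    exact one_mem (hU.Hup this)
  obtain ⟨p, hp, hd, hc⟩ := h2 N
  refine ⟨p.coeff 1 / 2, ?_⟩
  have := (U _).sub_mem hp ((U _).smul_mem (p.coeff 0) h0)
  convert this using 1
  nth_rw 2 [as_sum_range' p 3 (by omega)]
  simp [Finset.sum_range_succ, ← C_mul_X_pow_eq_monomial, hc, smul_eq_C_mul]
  have : C (2 * (p.coeff 1 / 2)) = C (p.coeff 1) := by congr 1; ring
  simp at this
  rw [this]; ring

lemma alpha (hU : GoodU U) (h2 : ∀ N, HH U 2 (2*N+1)) (hnf : ¬ ∀ n, U n = ⊤) :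
    ∃ a : ℂ, ∀ N, X^2 + C (2*a) * X ∈ U (2*N+1) := by
  choose a ha using hU.exA h2
  have l2 : X + C (a 0) ∈ U 2 := by
    have := hU.dup (ha 0)
    refine smul_cancel (c := 2) two_ne_zero (q := derivative (X^2 + C (2*a 0) * X)) ?_ ?_
    · exact this
    · simp [C2]; ring
  have rel : ∀ N : ℤ, (2*N-3 : ℂ) * a (N+1) = (2*N-1) * a N - 2 * a 0 := by
    intro N
    have hB := hU.br _ _ _ _ l2 (ha N)
    have hn : (2*N-3 : ℂ) ≠ 0 := by
      have : (2*N-3 : ℤ) ≠ 0 := by omega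
      exact_mod_cast this
    have : X^2 + C (2*(((2*N-1) * a N - 2 * a 0)/(2*N-3))) * X + C ((-4 * a N * a 0)/(2*N-3))
        ∈ U (2*(N+1)+1) := by
      refine smul_cancel hn (q := _) (by convert hB using 2; ring) ?_
      rw [mul_add (C (2*N-3 : ℂ)), mul_add (C (2*N-3 : ℂ)), ← mul_assoc (C (2*N-3 : ℂ)), ← C_mul, ← C_mul,
        show (2*N-3 : ℂ) * (2*(((2*N-1) * a N - 2 * a 0)/(2*N-3))) = 
          2*((2*N-1) * a N - 2 * a 0) by field_simp,
        show (2*N-3 : ℂ) * ((-4 * a N * a 0)/(2*N-3)) = -4 * a N * a 0 by field_simp]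
      simp [C2, C3, C4]; ring
    rw [hU.uniq h2 hnf (ha (N+1)) this]
    field_simp
  have hall : ∀ N, a N = a 0 := by
    intro N
    induction N using Int.induction_on with
    | zero => rfl
    | succ i ih =>
      have h := rel i
      have hn : (2*(i:ℤ)-3 : ℂ) ≠ 0 := by
        have : (2*(i:ℤ)-3 : ℤ) ≠ 0 := by omega
        exact_mod_cast this
      rw [ih] at h
      exact mul_left_cancel₀ hn (by rw [h]; ring)
    | pred i ih =>
      have h := rel (-i-1)
      have hn : (2*((-(i:ℤ)-1 : ℤ):ℂ)-1 : ℂ) ≠ 0 := by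
        have : (2*(-(i:ℤ)-1)-1 : ℤ) ≠ 0 := by omega
        exact_mod_cast this
      rw [sub_add_cancel, ih] at h
      exact mul_left_cancel₀ hn (by linear_combination -h)
  exact ⟨a 0, fun N => by rw [← hall N]; exact ha N⟩

lemma le_of (hU : GoodU U) {U' : ℤ → Submodule ℂ ℂ[X]} (hU' : GoodU U') {α : ℂ}
    (h2 : ∀ N, X^2 + C (2*α) * X ∈ U (2*N+1)) (h2' : ∀ N, X^2 + C (2*α) * X ∈ U' (2*N+1))
    (hnf : ¬ ∀ n, U n = ⊤) (n : ℤ) : U n ≤ U' n := by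
  have H2 : ∀ N, HH U 2 (2*N+1) := fun N => ⟨_, h2 N, by
    refine natDegree_add_le_of_degree_le (by simp) ((natDegree_C_mul_le _ _).trans (by simp)), by
    simp⟩
  have : ∀ d : ℕ, ∀ p : ℂ[X], p.natDegree < d → p ∈ U n → p ∈ U' n := by
    intro d
    induction d with
    | zero => intro p hp; omega
    | succ d ih =>
      intro p hp hpU
      by_cases hc : p.coeff d = 0
      · by_cases hd : d = 0
        · subst hd
          rw [eq_C_of_natDegree_le_zero (p := p) (by omega), hc]; simp
        · apply ih p _ hpU
          have : p.natDegree ≤ d - 1 := by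
            rw [natDegree_le_iff_coeff_eq_zero]
            intro N hN
            by_cases hNd : N = d
            · subst hNd; exact hc
            · exact coeff_eq_zero_of_natDegree_lt (by omega)
          omega
      have hHd : HH U d n := HH_of hpU (by omega) hc
      by_cases hpar : Odd (d + n)
      · have q1 := hU.gen h2 d n hpar
        have q2 := hU'.gen h2' d n hpar
        by_cases hd : d = 0
        · subst hd
          rw [eq_C_of_natDegree_le_zero (p := p) (by omega)]
          have := (U' n).smul_mem (p.coeff 0) q2
          rwa [pow_zero, smul_eq_C_mul, mul_one] at this
        have : p - p.coeff d • (X + C α)^d ∈ U' n := by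
          apply ih _ _ ((U n).sub_mem hpU ((U n).smul_mem _ q1))
          have hm : ((X + C α)^d).natDegree = d := by simp
          have hm' : ((X + C α)^d).coeff d = 1 := by
            have := (monic_X_add_C α).pow d
            rwa [Monic, leadingCoeff, hm] at this
          have : (p - p.coeff d • (X + C α)^d).natDegree ≤ d - 1 := by
            rw [natDegree_le_iff_coeff_eq_zero]
            intro N hN
            by_cases hNd : N = d
            · subst hNd; simp [hm']
            · rw [coeff_sub, coeff_smul, coeff_eq_zero_of_natDegree_lt (p := p) (by omega),
                coeff_eq_zero_of_natDegree_lt (p := (X + C α)^d) (by omega)]; simp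
          omega
        have := (U' n).add_mem this ((U' n).smul_mem (p.coeff d) q2)
        simpa using this
      · rw [Int.not_odd_iff_even] at hpar
        obtain ⟨c, hc'⟩ := hpar
        by_cases h1 : n + d = 0
        · by_cases h3 : n - d = 0
          · have hd : d = 0 := by omega
            have hn : n = 0 := by omega
            subst hd hn
            rw [eq_C_of_natDegree_le_zero (p := p) (by omega)]
            have := (U' 0).smul_mem (p.coeff 0) hU'.one0
            rwa [smul_eq_C_mul, mul_one] at this
          · exact (hnf (hU.full H2 (k := n - d) ⟨c - d, by omega⟩ h3
              (hU.Hdownd d (by simpa using hHd)))).elim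
        · exact (hnf (hU.full H2 (k := n + d) ⟨c, by omega⟩ h1
              (hU.Hupd d (by simpa using hHd)))).elim
  intro p hp
  exact this _ p (Nat.lt_succ_self _) hp
end GoodU
def EE (n : ℤ) : ℂ[X] →ₗ[ℂ] (ℝ × ℝ → ℂ) where
  toFun p := fun z => p.eval (z.2 : ℂ) * Complex.exp (Complex.I * (n : ℂ) * (z.1 : ℂ))
  map_add' p q := by funext z; simp [add_mul]
  map_smul' c p := by funext z; simp [mul_assoc]

lemma EE_apply (n : ℤ) (p : ℂ[X]) (z : ℝ × ℝ) :
    EE n p z = p.eval (z.2 : ℂ) * Complex.exp (Complex.I * (n : ℂ) * (z.1 : ℂ)) := rfl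

lemma eC_eq (r : ℕ) (m : ℤ) : eC r m = EE m (X ^ r) := by
  funext z; simp [eC, EE_apply]

lemma EE_dtheta (n : ℤ) (p : ℂ[X]) (z : ℝ × ℝ) :
    HasDerivAt (fun t : ℝ => EE n p (t, z.2)) (Complex.I * n * EE n p z) z.1 := by
  have h : HasDerivAt (fun t : ℝ => Complex.I * (n:ℂ) * (t:ℂ)) (Complex.I * n * 1) z.1 :=
    (HasDerivAt.ofReal_comp (hasDerivAt_id _)).const_mul _
  have := (h.cexp).const_mul (p.eval (z.2 : ℂ))
  refine HasDerivAt.congr_deriv (f := fun t : ℝ => EE n p (t, z.2)) this ?_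
  rw [EE_apply]; ring

lemma EE_dell (n : ℤ) (p : ℂ[X]) (z : ℝ × ℝ) :
    HasDerivAt (fun l : ℝ => EE n p (z.1, l)) (EE n (derivative p) z) z.2 := by
  have := (((p.hasDerivAt (z.2 : ℂ)).comp_ofReal)).mul_const
    (Complex.exp (Complex.I * (n : ℂ) * (z.1 : ℂ)))
  exact this

lemma pbC_EE (m n : ℤ) (p q : ℂ[X]) : pbC (EE m p) (EE n q) =
    Complex.I • EE (m+n) (C (n:ℂ) * (derivative p * q) - C (m:ℂ) * (p * derivative q)) := by
  funext z
  have a1 := (EE_dtheta m p z).deriv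
  have a2 := (EE_dtheta n q z).deriv
  have a3 := (EE_dell m p z).deriv
  have a4 := (EE_dell n q z).deriv
  simp only [pbC, pdEllC, pdThetaC, a1, a2, a3, a4, Pi.smul_apply]
  simp only [EE_apply, smul_eq_mul]
  have : Complex.exp (Complex.I * ((m+n : ℤ) : ℂ) * (z.1 : ℂ)) =
      Complex.exp (Complex.I * (m : ℂ) * (z.1 : ℂ)) * Complex.exp (Complex.I * (n : ℂ) * (z.1 : ℂ)) := by
    rw [← Complex.exp_add]; congr 1; push_cast; ring
  rw [this]
  simp; ring

def UU (T : Submodule ℂ (ℝ × ℝ → ℂ)) (n : ℤ) : Submodule ℂ ℂ[X] := T.comap (EE n)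

lemma mem_UU {T : Submodule ℂ (ℝ × ℝ → ℂ)} {n : ℤ} {p : ℂ[X]} : p ∈ UU T n ↔ EE n p ∈ T :=
  Iff.rfl

lemma goodUU {T : Submodule ℂ (ℝ × ℝ → ℂ)} (hT : IsLieSubC T) (h1 : (fun _ => 1) ∈ T)
    (h2 : eC 0 1 ∈ T) (h3 : eC 0 (-1) ∈ T) (h4 : eC 1 0 ∈ T) : GoodU (UU T) where
  br m n p q hp hq := by
    have := hT _ _ hp hq
    rw [pbC_EE] at this
    have := T.smul_mem (-Complex.I) this
    rw [smul_smul, neg_mul, Complex.I_mul_I, neg_neg, one_smul] at this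
    exact this
  one0 := by
    rw [mem_UU]; convert h1 using 1; funext z; simp [EE_apply]
  X0 := by rw [eC_eq] at h4; simpa [mem_UU] using h4
  one1 := by rw [eC_eq] at h2; simpa [mem_UU] using h2
  onem1 := by rw [eC_eq] at h3; simpa [mem_UU] using h3

lemma PC_rep {f : ℝ × ℝ → ℂ} (hf : f ∈ PC) :
    ∃ (s : Finset ℤ) (p : ℤ → ℂ[X]), f = ∑ n ∈ s, EE n (p n) := by
  have : PC ≤ LinearMap.range (Finsupp.lsum ℂ EE) := by
    unfold PC
    rw [Submodule.span_le]
    rintro _ ⟨r, m, rfl⟩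
    exact ⟨Finsupp.single m (X^r), by simp [eC_eq]⟩
  obtain ⟨g, rfl⟩ := this hf
  exact ⟨g.support, g, by simp [Finsupp.sum]⟩

lemma pbC_ell (f : ℝ × ℝ → ℂ) : pbC (eC 1 0) f = pdThetaC f := by
  funext z
  rw [eC_eq]
  simp only [pbC]
  have h1 : pdEllC (EE 0 (X^1)) z = 1 := by
    rw [pdEllC, (EE_dell _ _ _).deriv]; simp [EE_apply]
  have h2 : pdThetaC (EE 0 (X^1)) z = 0 := by
    rw [pdThetaC, (EE_dtheta _ _ _).deriv]; simp
  rw [h1, h2]; simp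

lemma pdTheta_sum (s : Finset ℤ) (p : ℤ → ℂ[X]) :
    pdThetaC (∑ n ∈ s, EE n (p n)) = ∑ n ∈ s, (Complex.I * (n:ℂ)) • EE n (p n) := by
  funext z
  have := HasDerivAt.fun_sum (u := s) (fun n _ => EE_dtheta n (p n) z)
  simp only [pdThetaC, Finset.sum_apply]
  rw [this.deriv]; simp

lemma decomp {T : Submodule ℂ (ℝ × ℝ → ℂ)} (hT : IsLieSubC T) (h4 : eC 1 0 ∈ T) (s : Finset ℤ) :
    ∀ p : ℤ → ℂ[X], (∑ n ∈ s, EE n (p n)) ∈ T → ∀ n ∈ s, EE n (p n) ∈ T := by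
  classical
  induction s using Finset.induction_on with
  | empty => intro p _ n hn; simp at hn
  | insert a s ha ih =>
    intro p hp
    have hd := hT _ _ h4 hp
    rw [pbC_ell, pdTheta_sum] at hd
    have hs := T.sub_mem hd (T.smul_mem (Complex.I * (a:ℂ)) hp)
    have e : (∑ n ∈ insert a s, (Complex.I * (n:ℂ)) • EE n (p n)) -
        (Complex.I * (a:ℂ)) • ∑ n ∈ insert a s, EE n (p n) =
        ∑ n ∈ s, EE n ((Complex.I * (n - a : ℂ)) • p n) := by
      rw [Finset.smul_sum, ← Finset.sum_sub_distrib, Finset.sum_insert ha]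
      simp only [sub_self, zero_add]
      refine Finset.sum_congr rfl fun n _ => ?_
      rw [map_smul, ← sub_smul]; congr 1; ring
    rw [e] at hs
    have hs' : ∀ n ∈ s, EE n (p n) ∈ T := by
      intro n hn
      have h := ih _ hs n hn
      have hne : (Complex.I * (n - a : ℂ)) ≠ 0 := by
        refine mul_ne_zero Complex.I_ne_zero (sub_ne_zero.2 ?_)
        have : n ≠ a := fun h => ha (h ▸ hn)
        exact_mod_cast this
      rw [map_smul] at h
      exact (T.smul_mem_iff hne).1 h
    intro n hn
    rcases Finset.mem_insert.1 hn with rfl | hn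
    · rw [Finset.sum_insert ha] at hp
      exact (T.add_mem_iff_left (T.sum_mem hs')).1 hp
    · exact hs' n hn

def reF (f : ℝ × ℝ → ℂ) : ℝ × ℝ → ℝ := fun z => (f z).re
def imF (f : ℝ × ℝ → ℂ) : ℝ × ℝ → ℝ := fun z => (f z).im

def SC (S : Submodule ℝ (ℝ × ℝ → ℝ)) : Submodule ℂ (ℝ × ℝ → ℂ) where
  carrier := {f | reF f ∈ S ∧ imF f ∈ S}
  add_mem' := by
    rintro a b ⟨h1, h2⟩ ⟨h3, h4⟩
    exact ⟨S.add_mem h1 h3, S.add_mem h2 h4⟩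
  zero_mem' := ⟨S.zero_mem, S.zero_mem⟩
  smul_mem' := by
    rintro c a ⟨h1, h2⟩
    refine ⟨?_, ?_⟩
    · have := S.sub_mem (S.smul_mem c.re h1) (S.smul_mem c.im h2)
      convert this using 1
      funext z; simp [reF, imF]
    · have := S.add_mem (S.smul_mem c.re h2) (S.smul_mem c.im h1)
      convert this using 1
      funext z; simp [reF, imF]

lemma mem_SC {S : Submodule ℝ (ℝ × ℝ → ℝ)} {f : ℝ × ℝ → ℂ} :
    f ∈ SC S ↔ reF f ∈ S ∧ imF f ∈ S := Iff.rfl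

lemma cplx_mem_SC {S : Submodule ℝ (ℝ × ℝ → ℝ)} {f : ℝ × ℝ → ℝ} : cplx f ∈ SC S ↔ f ∈ S := by
  have h1 : reF (cplx f) = f := by funext z; simp [reF, cplx]
  have h2 : imF (cplx f) = 0 := by funext z; simp [imF, cplx]
  rw [mem_SC, h1, h2]; simp

lemma P_diff {u : ℝ × ℝ → ℝ} (hu : u ∈ P) (z : ℝ × ℝ) :
    DifferentiableAt ℝ (fun t => u (t, z.2)) z.1 ∧ DifferentiableAt ℝ (fun l => u (z.1, l)) z.2 := by
  unfold P at hu
  induction hu using Submodule.span_induction with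
  | mem x hx =>
    obtain ⟨r, m, rfl | rfl⟩ := hx
    · constructor <;> simp only <;> fun_prop
    · constructor <;> simp only <;> fun_prop
  | zero => exact ⟨differentiableAt_const _, differentiableAt_const _⟩
  | add x y _ _ hx hy => exact ⟨hx.1.add hy.1, hx.2.add hy.2⟩
  | smul c x _ hx => exact ⟨hx.1.const_smul c, hx.2.const_smul c⟩

lemma deriv_split {f : ℝ → ℂ} {t : ℝ} (h1 : DifferentiableAt ℝ (fun t => (f t).re) t)
    (h2 : DifferentiableAt ℝ (fun t => (f t).im) t) :
    deriv f t = (deriv (fun t => (f t).re) t : ℝ) + (deriv (fun t => (f t).im) t : ℝ) * Complex.I := by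
  have := (h1.hasDerivAt.ofReal_comp).add ((h2.hasDerivAt.ofReal_comp).mul_const Complex.I)
  rw [← this.deriv]
  congr 1
  funext x
  simp [Complex.re_add_im]

lemma SC_lie {S : Submodule ℝ (ℝ × ℝ → ℝ)} (hLie : IsLieSub S) (hSP : S ≤ P) : IsLieSubC (SC S) := by
  rintro f g ⟨hf1, hf2⟩ ⟨hg1, hg2⟩
  have key : ∀ z, pbC f g z =
      (pb (reF f) (reF g) z - pb (imF f) (imF g) z : ℝ) +
      (pb (reF f) (imF g) z + pb (imF f) (reF g) z : ℝ) * Complex.I := by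
    intro z
    have a1 := deriv_split (f := fun t => f (t, z.2)) (P_diff (hSP hf1) z).1 (P_diff (hSP hf2) z).1
    have a2 := deriv_split (f := fun t => f (z.1, t)) (P_diff (hSP hf1) z).2 (P_diff (hSP hf2) z).2
    have a3 := deriv_split (f := fun t => g (t, z.2)) (P_diff (hSP hg1) z).1 (P_diff (hSP hg2) z).1
    have a4 := deriv_split (f := fun t => g (z.1, t)) (P_diff (hSP hg1) z).2 (P_diff (hSP hg2) z).2
    simp only [pbC, pdThetaC, pdEllC, a1, a2, a3, a4, pb, pdTheta, pdEll, reF, imF]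
    apply Complex.ext <;> simp <;> ring
  refine ⟨?_, ?_⟩
  · have := S.sub_mem (hLie _ _ hf1 hg1) (hLie _ _ hf2 hg2)
    convert this using 1
    funext z
    simp only [reF, key]; simp
  · have := S.add_mem (hLie _ _ hf1 hg2) (hLie _ _ hf2 hg1)
    convert this using 1
    funext z
    simp only [imF, key]; simp

lemma EE_re (n : ℤ) (p : ℂ[X]) (z : ℝ × ℝ) : EE n p z =
    p.eval (z.2 : ℂ) * (((Real.cos (n * z.1) : ℝ) : ℂ) + ((Real.sin (n * z.1) : ℝ) : ℂ) * Complex.I) := by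
  rw [EE_apply, show Complex.I * (n:ℂ) * (z.1:ℂ) = ((n * z.1 : ℝ) : ℂ) * Complex.I by push_cast; ring,
    Complex.exp_mul_I, Complex.ofReal_cos, Complex.ofReal_sin]

lemma cplx_mem_PC {u : ℝ × ℝ → ℝ} (hu : u ∈ P) : cplx u ∈ PC := by
  have hE : ∀ (r : ℕ) (m : ℤ), EE m (X^r) ∈ PC := fun r m =>
    Submodule.subset_span ⟨r, m, (eC_eq r m).symm⟩
  unfold P at hu
  induction hu using Submodule.span_induction with
  | mem x hx =>
    obtain ⟨r, m, rfl | rfl⟩ := hx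
    · have := PC.smul_mem (-Complex.I/2) (PC.sub_mem (hE r m) (hE r (-m)))
      convert this using 1
      funext z
      simp only [cplx, Pi.smul_apply, Pi.sub_apply, EE_re, smul_eq_mul]
      apply Complex.ext <;> simp <;> norm_cast <;> simp <;> ring
    · have := PC.smul_mem (1/2) (PC.add_mem (hE r m) (hE r (-m)))
      convert this using 1
      funext z
      simp only [cplx, Pi.smul_apply, Pi.add_apply, EE_re, smul_eq_mul]
      apply Complex.ext <;> simp <;> norm_cast <;> simp <;> ring
  | zero => 
    have : cplx 0 = 0 := by funext z; simp [cplx]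
    rw [this]; exact PC.zero_mem
  | add x y _ _ hx hy =>
    have : cplx (x + y) = cplx x + cplx y := by funext z; simp [cplx]
    rw [this]; exact PC.add_mem hx hy
  | smul c x _ hx =>
    have : cplx (c • x) = (c:ℂ) • cplx x := by funext z; simp [cplx]
    rw [this]; exact PC.smul_mem _ hx

lemma SC_le {S : Submodule ℝ (ℝ × ℝ → ℝ)} (hSP : S ≤ P) : SC S ≤ PC := by
  rintro f ⟨h1, h2⟩
  have := PC.add_mem (cplx_mem_PC (hSP h1)) (PC.smul_mem Complex.I (cplx_mem_PC (hSP h2)))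
  convert this using 1
  funext z
  simp only [cplx, reF, imF, Pi.add_apply, Pi.smul_apply, smul_eq_mul]
  rw [mul_comm, Complex.re_add_im]

lemma conj_UU {S : Submodule ℝ (ℝ × ℝ → ℝ)} {n : ℤ} {p : ℂ[X]} (hp : p ∈ UU (SC S) n) :
    p.map (starRingEnd ℂ) ∈ UU (SC S) (-n) := by
  have key : ∀ z, EE (-n) (p.map (starRingEnd ℂ)) z = starRingEnd ℂ (EE n p z) := by
    intro z
    have h : (p.map (starRingEnd ℂ)).eval (z.2 : ℂ) = starRingEnd ℂ (p.eval (z.2:ℂ)) := by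
      rw [← Polynomial.eval_map_apply, Complex.conj_ofReal]
    rw [EE_apply, EE_apply, h, map_mul, ← Complex.exp_conj]
    simp
  rw [mem_UU, mem_SC] at *
  refine ⟨?_, ?_⟩
  · convert hp.1 using 1
    funext z; simp [reF, key]
  · convert S.neg_mem hp.2 using 1
    funext z; simp [imF, key]

lemma re_P1 {n : ℤ} {p : ℂ[X]} (hp : p.natDegree ≤ 1) : reF (EE n p) ∈ P1 := by
  have hc : ∀ r : ℕ, r ≤ 1 → (fun z : ℝ × ℝ => z.2^r * Real.cos (n * z.1)) ∈ P1 := by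
    intro r hr
    refine Submodule.subset_span ⟨r, n.natAbs, hr, Or.inr ?_⟩
    funext z
    rw [Nat.cast_natAbs, Int.cast_abs]
    rcases abs_choice (n:ℝ) with h | h <;> rw [h] <;> simp
  have hs : ∀ r : ℕ, r ≤ 1 → (fun z : ℝ × ℝ => z.2^r * Real.sin (n * z.1)) ∈ P1 := by
    intro r hr
    have h : (fun z : ℝ × ℝ => z.2^r * Real.sin (n.natAbs * z.1)) ∈ P1 :=
      Submodule.subset_span ⟨r, n.natAbs, hr, Or.inl rfl⟩
    rw [Nat.cast_natAbs, Int.cast_abs] at h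
    rcases abs_choice (n:ℝ) with h' | h' <;> rw [h'] at h
    · exact h
    · have := P1.neg_mem h
      convert this using 1
      funext z; simp
  obtain ⟨a, b, rfl⟩ := exists_eq_X_add_C_of_natDegree_le_one hp
  have := P1.add_mem (P1.sub_mem (P1.smul_mem a.re (hc 1 le_rfl)) (P1.smul_mem a.im (hs 1 le_rfl)))
    (P1.sub_mem (P1.smul_mem b.re (hc 0 (by omega))) (P1.smul_mem b.im (hs 0 (by omega))))
  convert this using 1
  funext z
  simp [reF, EE_re, -Complex.ofReal_cos, -Complex.ofReal_sin]
  ring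

lemma im_EE (r : ℕ) (m : ℕ) : imF (EE m (X^r)) = fun p : ℝ × ℝ => p.2 ^ r * Real.sin (m * p.1) := by
  funext z
  simp only [imF, EE_re, eval_pow, eval_X, ← Complex.ofReal_pow, Complex.im_ofReal_mul]
  simp [-Complex.ofReal_cos, -Complex.ofReal_sin]
lemma re_EE (r : ℕ) (m : ℕ) : reF (EE m (X^r)) = fun p : ℝ × ℝ => p.2 ^ r * Real.cos (m * p.1) := by
  funext z
  simp only [reF, EE_re, eval_pow, eval_X, ← Complex.ofReal_pow, Complex.re_ofReal_mul]
  simp [-Complex.ofReal_cos, -Complex.ofReal_sin]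

lemma SC_basic {S : Submodule ℝ (ℝ × ℝ → ℝ)} (hBS : Bsub ≤ S) :
    (fun _ => 1) ∈ SC S ∧ eC 0 1 ∈ SC S ∧ eC 0 (-1) ∈ SC S ∧ eC 1 0 ∈ SC S := by
  have h1 : cplx fone ∈ SC S := cplx_mem_SC.2 (hBS (Submodule.subset_span (by simp)))
  have h2 : cplx fell ∈ SC S := cplx_mem_SC.2 (hBS (Submodule.subset_span (by simp)))
  have h3 : cplx fsin ∈ SC S := cplx_mem_SC.2 (hBS (Submodule.subset_span (by simp)))
  have h4 : cplx fcos ∈ SC S := cplx_mem_SC.2 (hBS (Submodule.subset_span (by simp)))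
  refine ⟨?_, ?_, ?_, ?_⟩
  · convert h1 using 1; funext z; simp [cplx, fone]
  · convert (SC S).add_mem h4 ((SC S).smul_mem Complex.I h3) using 1
    funext z; rw [eC_eq, EE_re]; simp [cplx, fsin, fcos]; ring
  · convert (SC S).sub_mem h4 ((SC S).smul_mem Complex.I h3) using 1
    funext z; rw [eC_eq, EE_re]; simp [cplx, fsin, fcos]; ring
  · convert h2 using 1; funext z; rw [eC_eq, EE_re]; simp [cplx, fell]

end

/-- Every proper Lie subalgebra of `P` containing `B` either lies in `P¹` or equals
some `V_α`. -/
theorem stmt11 (S : Submodule ℝ (ℝ × ℝ → ℝ)) (hLie : IsLieSub S) (hSP : S ≤ P)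
    (hBS : Bsub ≤ S) (hne : S ≠ P) :
    S ≤ P1 ∨ ∃ α : ℝ, S = V α := by
  have hL := SC_lie hLie hSP
  obtain ⟨b1, b2, b3, b4⟩ := SC_basic hBS
  have hU := goodUU hL b1 b2 b3 b4
  have hnf : ¬ ∀ n, UU (SC S) n = ⊤ := by
    intro h
    apply hne
    refine le_antisymm hSP ?_
    unfold P
    rw [Submodule.span_le]
    have hm : ∀ r m : ℕ, EE (m:ℤ) (Polynomial.X^r) ∈ SC S := fun r m => by
      rw [← mem_UU, h]; trivial
    rintro _ ⟨r, m, rfl | rfl⟩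
    · rw [← im_EE]; exact (hm r m).2
    · rw [← re_EE]; exact (hm r m).1
  by_cases hdeg : ∀ n, ∀ p ∈ UU (SC S) n, p.natDegree ≤ 1
  · left
    intro f hf
    have hf' : cplx f ∈ SC S := cplx_mem_SC.2 hf
    obtain ⟨s, p, hsp⟩ := PC_rep (SC_le hSP hf')
    have hd := decomp hL b4 s p (hsp ▸ hf')
    have : f = ∑ n ∈ s, reF (EE n (p n)) := by
      funext z
      have := congrArg Complex.re (congrFun hsp z)
      simpa [cplx, reF] using this
    rw [this]
    exact P1.sum_mem fun n hn => re_P1 (hdeg n _ (hd n hn))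
  · right
    push Not at hdeg
    obtain ⟨n, p, hp, hpd⟩ := hdeg
    have hconj : ∀ r n, HH (UU (SC S)) r n → HH (UU (SC S)) r (-n) := by
      rintro r n ⟨q, hq, hqd, hqc⟩
      exact ⟨_, conj_UU hq, (Polynomial.natDegree_map_le).trans hqd, by simp [hqc]⟩
    have hH : HH (UU (SC S)) p.natDegree n := GoodU.HH_of hp le_rfl (by
      rw [Polynomial.coeff_natDegree, Polynomial.leadingCoeff_ne_zero]
      rintro rfl; simp at hpd)
    have h2 := hU.H2of hconj hpd hH
    obtain ⟨a, ha⟩ := hU.alpha h2 hnf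
    have hreal : a = starRingEnd ℂ a := by
      have h := conj_UU (ha (-1))
      refine hU.uniq h2 hnf (N := 0) (c := 0) (ha 0) ?_
      have e2 : (starRingEnd ℂ) 2 = 2 := map_ofNat _ 2
      simpa [e2] using h
    obtain ⟨α, rfl⟩ : ∃ α : ℝ, (α : ℂ) = a := Complex.conj_eq_iff_real.1 hreal.symm |>.imp
      fun _ h => h.symm
    refine ⟨α, ?_⟩
    have hgen : ∀ N : ℤ, eC 2 (2 * N + 1) + (2 * α : ℂ) • eC 1 (2 * N + 1) =
        EE (2*N+1) (Polynomial.X^2 + Polynomial.C (2*(α:ℂ)) * Polynomial.X) := by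
      intro N
      rw [eC_eq, eC_eq, ← map_smul, ← map_add, Polynomial.smul_eq_C_mul, pow_one]
    have hW : W α = SC S := by
      apply le_antisymm
      · refine sInf_le ⟨SC_le hSP, ?_, hL⟩
        rintro f (hf | ⟨N, rfl⟩)
        · rcases hf with rfl | rfl | rfl | rfl <;> assumption
        · rw [hgen]; exact ha N
      · refine le_sInf ?_
        rintro T ⟨-, hTg, hTL⟩
        have t1 : (fun _ => 1) ∈ T := hTg (Or.inl (by simp))
        have t2 : eC 0 1 ∈ T := hTg (Or.inl (by simp))
        have t3 : eC 0 (-1) ∈ T := hTg (Or.inl (by simp))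
        have t4 : eC 1 0 ∈ T := hTg (Or.inl (by simp))
        have hle := hU.le_of (goodUU hTL t1 t2 t3 t4) ha
          (fun N => by rw [mem_UU, ← hgen]; exact hTg (Or.inr ⟨N, rfl⟩)) hnf
        intro f hf
        obtain ⟨s, p, hsp⟩ := PC_rep (SC_le hSP hf)
        have hd := decomp hL b4 s p (hsp ▸ hf)
        rw [hsp]
        exact T.sum_mem fun n hn => hle n (hd n hn)
    ext f
    change f ∈ S ↔ cplx f ∈ W α
    rw [hW, cplx_mem_SC]
end
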